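/- Let K be a compact Hausdorff space and let f : C(K) → ℂ be an orthogonally additive holomorphic function of bounded type with Taylor expansion f = ∑_{k≥1} P_k at zero. Then for each k there exists a complex Borel measure ν_k on the weak-* closed unit ball B' of the dual of C(K) such that P_k(x) = ∫_{B'} γ(x)^k dν_k(γ) for all x ∈ C(K) and ∑_{k≥1} |ν_k|(B') < ∞; in particular the sum of the integral norms of the Taylor polynomials of f is finite. -/

import Mathlib

open MeasureTheory Filter Topology

open MeasureTheory Filter Topology

/-- `f` is orthogonally additive when it is additive on orthogonal pairs. -/
def IsOrthAdd {K : Type*} [TopologicalSpace K] [CompactSpace K]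
    (f : C(K, ℂ) → ℂ) : Prop :=
  ∀ x y : C(K, ℂ), x * y = 0 → f (x + y) = f x + f y

/-- `P` is a continuous `k`-homogeneous polynomial on `C(K, ℂ)`. -/
def IsHomogPoly {K : Type*} [TopologicalSpace K] [CompactSpace K]
    (k : ℕ) (P : C(K, ℂ) → ℂ) : Prop :=
  ∃ M : ContinuousMultilinearMap ℂ (fun _ : Fin k => C(K, ℂ)) ℂ,
    ∀ x : C(K, ℂ), P x = M (fun _ => x)

/-- The norm `‖P‖ = sup_{‖x‖ ≤ 1} |P x|` of a polynomial on `C(K, ℂ)`. -/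
noncomputable def polyNorm {K : Type*} [TopologicalSpace K] [CompactSpace K]
    (P : C(K, ℂ) → ℂ) : ℝ :=
  sSup ((fun x => ‖P x‖) '' Metric.closedBall (0 : C(K, ℂ)) 1)

/-- The closed unit ball of the dual of `C(K, ℂ)`, with the weak-* topology. -/
abbrev DualBall (K : Type*) [TopologicalSpace K] [CompactSpace K] : Type _ :=
  {γ : WeakDual ℂ C(K, ℂ) // ∀ x : C(K, ℂ), ‖γ x‖ ≤ ‖x‖}

/-- Borel σ-algebra on the weak-* dual unit ball. -/
noncomputable instance (K : Type*) [TopologicalSpace K] [CompactSpace K] :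
    MeasurableSpace (DualBall K) := borel (DualBall K)



namespace OA

lemma sum_toggle {k : ℕ} (F : Finset (Fin k) → ℂ) (a : Fin k)
    (hF : ∀ T, F (symmDiff T {a}) = F T) :
    ∑ T : Finset (Fin k), (-1 : ℂ) ^ T.card * F T = 0 := by
  have hc : ∀ T : Finset (Fin k), (-1 : ℂ) ^ (symmDiff T {a}).card = - (-1) ^ T.card := by
    intro T
    by_cases h : a ∈ T
    · have h1 : symmDiff T {a} = T.erase a := by
        ext b; simp only [Finset.mem_symmDiff, Finset.mem_singleton, Finset.mem_erase]
        by_cases hb : b = a <;> simp_all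
      have h2 := Finset.card_erase_add_one h
      rw [h1, ← h2, pow_succ]; ring
    · have h1 : symmDiff T {a} = insert a T := by
        ext b; simp only [Finset.mem_symmDiff, Finset.mem_singleton, Finset.mem_insert]
        by_cases hb : b = a <;> simp_all
      rw [h1, Finset.card_insert_of_notMem h, pow_succ]; ring
  refine Finset.sum_involution (fun T _ => symmDiff T {a}) ?_ ?_ ?_ ?_
  · intro T _; rw [hc, hF]; ring
  · intro T _ _ h
    have : a ∈ symmDiff T {a} ↔ a ∈ T := by rw [h]
    simp [Finset.mem_symmDiff] at this
  · intro T _; exact Finset.mem_univ _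
  · intro T _; simp

lemma polarization {E : Type*} [AddCommGroup E] [Module ℂ E] {k : ℕ}
    (M : MultilinearMap ℂ (fun _ : Fin k => E) ℂ) (z : Fin k → E) :
    ∑ T : Finset (Fin k), (-1 : ℂ) ^ T.card * M (fun _ => ∑ i ∈ T, z i)
      = (-1) ^ k * ∑ σ : Equiv.Perm (Fin k), M (fun j => z (σ j)) := by
  classical
  have h1 : ∀ T : Finset (Fin k), M (fun _ => ∑ i ∈ T, z i)
      = ∑ g : Fin k → Fin k, if (∀ j, g j ∈ T) then M (fun j => z (g j)) else 0 := by
    intro T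
    rw [MultilinearMap.map_sum_finset, ← Finset.sum_filter]
    congr 1
    ext g; simp
  simp_rw [h1, Finset.mul_sum]
  rw [Finset.sum_comm]
  have h2 : ∀ g : Fin k → Fin k, (∑ T : Finset (Fin k), (-1 : ℂ) ^ T.card *
      (if (∀ j, g j ∈ T) then M (fun j => z (g j)) else 0)) =
      if Function.Bijective g then (-1) ^ k * M (fun j => z (g j)) else 0 := by
    intro g
    split_ifs with hg
    · rw [Finset.sum_eq_single Finset.univ]
      · simp
      · intro T _ hT
        rw [if_neg, mul_zero]
        intro h
        apply hT
        ext i; obtain ⟨j, rfl⟩ := hg.2 i; simp [h j]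
      · simp
    · have : ¬ Function.Surjective g := fun h => hg (Finite.surjective_iff_bijective.1 h)
      simp only [Function.Surjective, not_forall, not_exists] at this
      obtain ⟨a, ha⟩ := this
      apply sum_toggle _ a
      intro T
      have : (∀ j, g j ∈ symmDiff T {a}) ↔ ∀ j, g j ∈ T := by
        refine forall_congr' fun j => ?_
        simp [Finset.mem_symmDiff, ha j]
      simp only [this]
  rw [Finset.sum_congr rfl (fun g _ => h2 g), ← Finset.sum_filter]
  symm
  refine Finset.sum_bij (fun (σ : Equiv.Perm (Fin k)) _ => (σ : Fin k → Fin k)) ?_ ?_ ?_ ?_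
  · intro σ _; exact Finset.mem_filter.2 ⟨Finset.mem_univ _, σ.bijective⟩
  · intro σ _ τ _ h; exact DFunLike.coe_injective h
  · intro g hg
    simp only [Finset.mem_filter, Finset.mem_univ, true_and] at hg
    exact ⟨Equiv.ofBijective g hg, Finset.mem_univ _, rfl⟩
  · intro σ _; rfl

/-- symmetrization, as a multilinear map -/
noncomputable def sym {E : Type*} [NormedAddCommGroup E] [NormedSpace ℂ E] {k : ℕ}
    (M : ContinuousMultilinearMap ℂ (fun _ : Fin k => E) ℂ) :
    ContinuousMultilinearMap ℂ (fun _ : Fin k => E) ℂ :=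
  ∑ σ : Equiv.Perm (Fin k), M.domDomCongr σ

lemma sym_apply {E : Type*} [NormedAddCommGroup E] [NormedSpace ℂ E] {k : ℕ}
    (M : ContinuousMultilinearMap ℂ (fun _ : Fin k => E) ℂ) (z : Fin k → E) :
    sym M z = ∑ σ : Equiv.Perm (Fin k), M (fun j => z (σ j)) := by
  simp [sym]

lemma sym_eq {E : Type*} [NormedAddCommGroup E] [NormedSpace ℂ E] {k : ℕ}
    (M : ContinuousMultilinearMap ℂ (fun _ : Fin k => E) ℂ) (z : Fin k → E) :
    sym M z = (-1) ^ k * ∑ T : Finset (Fin k), (-1 : ℂ) ^ T.card * M (fun _ => ∑ i ∈ T, z i) := by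
  have := polarization M.toMultilinearMap z
  simp only [ContinuousMultilinearMap.coe_coe] at this
  rw [this, sym_apply, ← mul_assoc, ← mul_pow]; simp

lemma sym_diag {E : Type*} [NormedAddCommGroup E] [NormedSpace ℂ E] {k : ℕ}
    (M : ContinuousMultilinearMap ℂ (fun _ : Fin k => E) ℂ) (x : E) :
    sym M (fun _ => x) = k.factorial * M (fun _ => x) := by
  rw [sym_apply]; simp [Fintype.card_perm]

lemma sym_bound {E : Type*} [NormedAddCommGroup E] [NormedSpace ℂ E] {k : ℕ}
    (M : ContinuousMultilinearMap ℂ (fun _ : Fin k => E) ℂ) (C : ℝ)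
    (hC : ∀ x, ‖M (fun _ => x)‖ ≤ C * ‖x‖ ^ k) (hC0 : 0 ≤ C) (z : Fin k → E)
    (hz : ∀ i, ‖z i‖ ≤ 1) : ‖sym M z‖ ≤ 2 ^ k * (C * k ^ k) := by
  rw [sym_eq, norm_mul]
  simp only [norm_pow, norm_neg, norm_one, one_pow, one_mul]
  refine (norm_sum_le _ _).trans ?_
  have : ∀ T ∈ (Finset.univ : Finset (Finset (Fin k))),
      ‖(-1 : ℂ) ^ T.card * M (fun _ => ∑ i ∈ T, z i)‖ ≤ C * k ^ k := by
    intro T _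
    rw [norm_mul]
    simp only [norm_pow, norm_neg, norm_one, one_pow, one_mul]
    refine (hC _).trans ?_
    gcongr
    refine (norm_sum_le _ _).trans ((Finset.sum_le_card_nsmul _ _ 1 (fun i _ => hz i)).trans ?_)
    simp only [nsmul_eq_mul, mul_one]
    exact_mod_cast (Finset.card_le_univ T).trans (by simp)
  refine (Finset.sum_le_card_nsmul _ _ _ this).trans ?_
  simp

lemma sym_vanish {K : Type*} [TopologicalSpace K] [CompactSpace K] {k : ℕ}
    (M : ContinuousMultilinearMap ℂ (fun _ : Fin k => C(K, ℂ)) ℂ)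
    (hM : IsOrthAdd fun x => M (fun _ => x)) (z : Fin k → C(K, ℂ)) (A : Set (Fin k))
    (a b : Fin k) (ha : a ∈ A) (hb : b ∉ A)
    (hz : ∀ i ∈ A, ∀ j ∉ A, z i * z j = 0) : sym M z = 0 := by
  classical
  have h1 : ∀ T : Finset (Fin k), M (fun _ => ∑ i ∈ T, z i) =
      M (fun _ => ∑ i ∈ T with i ∈ A, z i) + M (fun _ => ∑ i ∈ T with i ∉ A, z i) := by
    intro T
    rw [← hM, Finset.sum_filter_add_sum_filter_not]
    rw [Finset.sum_mul_sum]
    refine Finset.sum_eq_zero fun i hi => Finset.sum_eq_zero fun j hj => ?_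
    exact hz i (Finset.mem_filter.1 hi).2 j (Finset.mem_filter.1 hj).2
  rw [sym_eq]
  rw [Finset.sum_congr rfl (fun T _ => by rw [h1 T, mul_add]), Finset.sum_add_distrib]
  rw [sum_toggle _ b, sum_toggle _ a]
  · simp
  · intro T
    congr 1; ext1 _
    congr 1
    ext i
    by_cases h : i = a <;> simp_all [Finset.mem_symmDiff]
  · intro T
    congr 1; ext1 _
    congr 1
    ext i
    by_cases h : i = b <;> simp_all [Finset.mem_symmDiff]


lemma cluster {K : Type*} [TopologicalSpace K] [CompactSpace K] {k : ℕ}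
    (S : ContinuousMultilinearMap ℂ (fun _ : Fin k => C(K, ℂ)) ℂ)
    (hS : ∀ (z : Fin k → C(K, ℂ)) (A : Set (Fin k)) (a b : Fin k), a ∈ A → b ∉ A →
      (∀ i ∈ A, ∀ j ∉ A, z i * z j = 0) → S z = 0)
    (U : ℕ → C(K, ℂ)) (hU : ∀ i j, i + 2 ≤ j → U i * U j = 0) (i : Fin k → ℕ)
    (hi : S (fun j => U (i j)) ≠ 0) (a b : Fin k) : i b < i a + 2 * k := by
  by_contra h
  push Not at h
  have hk : 0 < k := a.pos
  have : ∃ m ∈ Finset.Ico (i a) (i b), m ∉ Finset.univ.image i := by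
    by_contra hcon
    push Not at hcon
    have h1 := Finset.card_le_card (show Finset.Ico (i a) (i b) ⊆ Finset.univ.image i from hcon)
    have h2 := Finset.card_image_le (s := (Finset.univ : Finset (Fin k))) (f := i)
    simp at h1 h2
    omega
  obtain ⟨m, hm, hm'⟩ := this
  rw [Finset.mem_Ico] at hm
  have hne : ∀ j, i j ≠ m := fun j hj => hm' (by simp [← hj])
  apply hi
  refine hS _ {j | i j < m} a b ?_ ?_ ?_
  · exact lt_of_le_of_ne hm.1 (hne a)
  · simp; omega
  · intro p hp q hq
    simp at hp hq
    apply hU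
    have := hne q
    omega

lemma prod_sub_pow {k : ℕ} (c : Fin k → ℂ) (d : ℂ) (ε : ℝ) (hc : ∀ j, ‖c j‖ ≤ 1) (hd : ‖d‖ ≤ 1)
    (h : ∀ j, ‖c j - d‖ ≤ ε) : ‖∏ j, c j - d ^ k‖ ≤ k * ε := by
  induction k with
  | zero => simp
  | succ k ih =>
    rw [Fin.prod_univ_succ]
    have := ih (fun j => c j.succ) (fun j => hc _) (fun j => h _)
    have e : c 0 * ∏ i : Fin k, c i.succ - d ^ (k + 1) =
      c 0 * (∏ i : Fin k, c i.succ - d ^ k) + (c 0 - d) * d ^ k := by ring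
    rw [e]
    refine (norm_add_le _ _).trans ?_
    rw [norm_mul, norm_mul, norm_pow]
    have h1 : ‖d‖ ^ k ≤ 1 := pow_le_one₀ (norm_nonneg _) hd
    have h2 := h 0
    have h3 := hc 0
    have h4 : ‖c 0‖ * ‖∏ i : Fin k, c i.succ - d ^ k‖ ≤ 1 * (k * ε) :=
      mul_le_mul h3 this (norm_nonneg _) zero_le_one
    have h5 : ‖c 0 - d‖ * ‖d‖ ^ k ≤ ε * 1 :=
      mul_le_mul h2 h1 (by positivity) ((norm_nonneg _).trans h2)
    push_cast
    linarith

lemma discr {K : Type*} [TopologicalSpace K] [CompactSpace K] {k : ℕ} (o : Fin k)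
    (S : ContinuousMultilinearMap ℂ (fun _ : Fin k => C(K, ℂ)) ℂ)
    (hS : ∀ (z : Fin k → C(K, ℂ)) (A : Set (Fin k)) (a b : Fin k), a ∈ A → b ∉ A →
      (∀ i ∈ A, ∀ j ∉ A, z i * z j = 0) → S z = 0)
    (U : ℕ → C(K, ℂ)) (hU : ∀ i j, i + 2 ≤ j → U i * U j = 0) (N : ℕ)
    (hb : ∀ (a : ℕ → ℂ) (R : ℝ) (I : Finset ℕ), 0 ≤ R → I ⊆ Finset.range (N + 1) →
      (∀ n ∈ I, ‖a n‖ ≤ R) → ‖∑ n ∈ I, a n • U n‖ ≤ R)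
    (c : ℕ → ℂ) (hc : ∀ n ≤ N, ‖c n‖ ≤ 1) (δ : ℝ) (hδ : 0 ≤ δ)
    (hcd : ∀ n m, n < m + 2 * k → m < n + 2 * k → ‖c n - c m‖ ≤ δ) :
    ‖S (fun _ => ∑ n ∈ Finset.range (N + 1), c n • U n) -
      S (Function.update (fun _ => ∑ n ∈ Finset.range (N + 1), (1 : ℂ) • U n) o
        (∑ n ∈ Finset.range (N + 1), (c n) ^ k • U n))‖ ≤ (4 * k) ^ k * (‖S‖ * (k * δ)) := by
  classical
  have hk : 0 < k := o.pos
  set I := Finset.range (N + 1) with hI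
  have key : ∀ (J : Fin k → Finset ℕ) (a : Fin k → ℕ → ℂ),
      S (fun j => ∑ n ∈ J j, a j n • U n) =
        ∑ i ∈ Fintype.piFinset J, (∏ j, a j (i j)) * S (fun j => U (i j)) := by
    intro J a
    rw [ContinuousMultilinearMap.map_sum_finset]
    refine Finset.sum_congr rfl fun i _ => ?_
    rw [ContinuousMultilinearMap.map_smul_univ, smul_eq_mul]
  have hupd : (Function.update (fun _ => ∑ n ∈ I, (1 : ℂ) • U n) o
        (∑ n ∈ I, (c n) ^ k • U n)) =
        fun j => ∑ n ∈ I, (if j = o then c n ^ k else 1) • U n := by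
    ext1 j
    by_cases h : j = o
    · subst h; simp
    · simp [h]
  have hprod : ∀ (D : ℕ → ℂ) (i : Fin k → ℕ), ∏ j, (if j = o then D (i j) else 1) = D (i o) := by
    intro D i
    rw [Finset.prod_ite_eq' Finset.univ o]; simp
  rw [hupd, key (fun _ => I) (fun _ => c), key (fun _ => I) (fun j n => if j = o then c n ^ k else 1),
    ← Finset.sum_sub_distrib]
  have L0 : 0 < 4 * k := by omega
  -- group by residues
  let ρ : (Fin k → ℕ) → (Fin k → Fin (4 * k)) := fun i j => ⟨i j % (4 * k), Nat.mod_lt _ L0⟩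
  rw [← Finset.sum_fiberwise _ ρ]
  have main : ∀ r : Fin k → Fin (4 * k),
      ‖∑ i ∈ Fintype.piFinset (fun _ : Fin k => I) with ρ i = r,
        ((∏ j, c (i j)) * S (fun j => U (i j)) -
          (∏ j, if j = o then c (i j) ^ k else 1) * S (fun j => U (i j)))‖ ≤ ‖S‖ * (k * δ) := by
    intro r
    let good : ℕ → Fin k → ℕ → Prop := fun m j n =>
      n ≤ N ∧ n % (4 * k) = r j ∧ n < m + 2 * k ∧ m < n + 2 * k
    let τ : ℕ → Fin k → ℕ := fun m j => if h : ∃ n, good m j n then h.choose else m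
    let D : ℕ → ℂ := fun m => ∏ j, c (τ m j) - c m ^ k
    have hτ : ∀ m j n, good m j n → τ m j = n := by
      intro m j n hn
      have h : ∃ n, good m j n := ⟨n, hn⟩
      have e : τ m j = h.choose := dif_pos h
      have h' := h.choose_spec
      rw [e]
      generalize h.choose = n' at h'
      obtain ⟨_, h2, h3, h4⟩ := hn
      obtain ⟨_, h2', h3', h4'⟩ := h'
      have : n ≡ n' [MOD (4 * k)] := by rw [Nat.ModEq, h2, h2']
      rcases le_total n n' with hle | hle
      · have := (Nat.modEq_iff_dvd' hle).1 this
        have := Nat.eq_zero_of_dvd_of_lt this (by omega)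
        omega
      · have := (Nat.modEq_iff_dvd' hle).1 this.symm
        have := Nat.eq_zero_of_dvd_of_lt this (by omega)
        omega
    have hτ' : ∀ m ≤ N, ∀ j, τ m j ≤ N ∧ ‖c (τ m j) - c m‖ ≤ δ := by
      intro m hm j
      by_cases h : ∃ n, good m j n
      · obtain ⟨n, hn⟩ := h
        rw [hτ m j n hn]
        exact ⟨hn.1, hcd _ _ hn.2.2.1 hn.2.2.2⟩
      · have e : τ m j = m := dif_neg h
        rw [e]; simp [hm, hδ]
    have hD : ∀ m ≤ N, ‖D m‖ ≤ k * δ := fun m hm =>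
      prod_sub_pow _ _ _ (fun j => hc _ (hτ' m hm j).1) (hc m hm) (fun j => (hτ' m hm j).2)
    have hset : (Fintype.piFinset (fun _ : Fin k => I)).filter (fun i => ρ i = r) =
        Fintype.piFinset (fun j : Fin k => I.filter (fun n => n % (4 * k) = r j)) := by
      ext i
      simp only [Finset.mem_filter, Fintype.mem_piFinset, ρ, funext_iff, Fin.ext_iff, forall_and]
    rw [hset]
    have hterm : ∀ i ∈ Fintype.piFinset (fun j : Fin k => I.filter (fun n => n % (4 * k) = r j)),
        ((∏ j, c (i j)) * S (fun j => U (i j)) -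
          (∏ j, if j = o then c (i j) ^ k else 1) * S (fun j => U (i j))) =
        (∏ j, if j = o then D (i j) else 1) * S (fun j => U (i j)) := by
      intro i hi
      rw [hprod (fun n => c n ^ k), hprod D, ← sub_mul]
      by_cases hz : S (fun j => U (i j)) = 0
      · simp [hz]
      congr 1
      have : ∀ j, τ (i o) j = i j := by
        intro j
        apply hτ
        have h1 := Fintype.mem_piFinset.1 hi j
        rw [Finset.mem_filter, hI, Finset.mem_range] at h1
        exact ⟨by omega, h1.2, cluster S hS U hU i hz o j, cluster S hS U hU i hz j o⟩
      simp [D, this]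
    rw [Finset.sum_congr rfl hterm,
      ← key (fun j : Fin k => I.filter (fun n => n % (4 * k) = r j))
        (fun j n => if j = o then D n else 1)]
    refine (S.le_opNorm _).trans ?_
    gcongr
    have hkδ : 0 ≤ (k : ℝ) * δ := by positivity
    have : ∏ j : Fin k, (if j = o then (k : ℝ) * δ else 1) = k * δ := by
      rw [Finset.prod_ite_eq' Finset.univ o]; simp
    rw [← this]
    refine Finset.prod_le_prod (fun _ _ => norm_nonneg _) fun j _ => ?_
    refine hb _ _ _ ?_ (Finset.filter_subset _ _) ?_
    · split_ifs <;> positivity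
    · intro n hn
      have hn' := (Finset.mem_filter.1 hn).1
      rw [hI, Finset.mem_range] at hn'
      split_ifs
      · exact hD n (by omega)
      · simp
  refine (norm_sum_le _ _).trans ((Finset.sum_le_card_nsmul _ _ _ (fun r _ => main r)).trans ?_)
  simp

lemma hats {K : Type*} [TopologicalSpace K] [CompactSpace K] (N : ℕ) (y : C(K, ℝ))
    (hy0 : ∀ t, 0 ≤ y t) (hyN : ∀ t, y t ≤ N) :
    ∃ U : ℕ → C(K, ℂ), (∀ i j, i + 2 ≤ j → U i * U j = 0) ∧
      (∑ n ∈ Finset.range (N + 1), U n = 1) ∧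
      (∀ (a : ℕ → ℂ) (R : ℝ) (I : Finset ℕ), 0 ≤ R → I ⊆ Finset.range (N + 1) →
        (∀ n ∈ I, ‖a n‖ ≤ R) → ‖∑ n ∈ I, a n • U n‖ ≤ R) ∧
      (∀ (a : ℕ → ℂ) (R : ℝ) (v : C(K, ℂ)), 0 ≤ R →
        (∀ n t, n ≤ N → |y t - n| ≤ 1 → ‖a n - v t‖ ≤ R) →
          ‖∑ n ∈ Finset.range (N + 1), a n • U n - v‖ ≤ R) := by
  let g : ℕ → K → ℝ := fun i t => max 0 (min 1 (y t - i + 1))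
  let u : ℕ → K → ℝ := fun i t => g i t - g (i + 1) t
  have hu0 : ∀ i t, 0 ≤ u i t := by
    intro i t
    simp only [u, g, sub_nonneg]
    push_cast
    apply max_le_max le_rfl (min_le_min le_rfl _)
    linarith
  have hus : ∀ (i : ℕ) t, 1 < |y t - i| → u i t = 0 := by
    intro i t h
    simp only [u, g]
    push_cast
    rcases lt_abs.1 h with h | h
    · rw [min_eq_left (by linarith), min_eq_left (by linarith)]; simp
    · rw [max_eq_left, max_eq_left]; · simp
      · exact (min_le_right _ _).trans (by linarith)
      · exact (min_le_right _ _).trans (by linarith)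
  have husum : ∀ t, ∑ n ∈ Finset.range (N + 1), u n t = 1 := by
    intro t
    have := Finset.sum_range_sub' (fun i => g i t) (N + 1)
    simp only [u]
    rw [this]
    simp only [g]
    push_cast
    have h1 := hy0 t
    have h2 := hyN t
    rw [min_eq_left (by linarith), max_eq_left ((min_le_right _ _).trans (by linarith))]
    simp
  have huu : ∀ i j, i + 2 ≤ j → ∀ t, u i t * u j t = 0 := by
    intro i j hij t
    have hij' : (i : ℝ) + 2 ≤ j := by exact_mod_cast hij
    by_cases h : y t ≤ i + 1
    · have : u j t = 0 := by
        simp only [u, g]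
        push_cast
        rw [max_eq_left ((min_le_right _ _).trans (by linarith)),
          max_eq_left ((min_le_right _ _).trans (by linarith))]; simp
      rw [this, mul_zero]
    · have : u i t = 0 := by
        apply hus
        rw [lt_abs]; left; linarith
      rw [this, zero_mul]
  have hcont : ∀ i, Continuous fun t => ((u i t : ℝ) : ℂ) := by
    intro i
    simp only [u, g]
    fun_prop
  have hub : ∀ (b : ℕ → ℂ) (R : ℝ) (I : Finset ℕ) (t : K), 0 ≤ R → I ⊆ Finset.range (N + 1) →
        (∀ n ∈ I, u n t ≠ 0 → ‖b n‖ ≤ R) → ‖∑ n ∈ I, b n * (u n t : ℂ)‖ ≤ R := by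
    intro b R I t hR hI hb
    calc ‖∑ n ∈ I, b n * (u n t : ℂ)‖ ≤ ∑ n ∈ I, ‖b n * (u n t : ℂ)‖ := norm_sum_le _ _
      _ ≤ ∑ n ∈ I, R * u n t := by
          refine Finset.sum_le_sum fun n hn => ?_
          by_cases h : u n t = 0
          · simp [h]
          · rw [norm_mul, Complex.norm_real, Real.norm_of_nonneg (hu0 n t)]
            exact mul_le_mul_of_nonneg_right (hb n hn h) (hu0 n t)
      _ = R * ∑ n ∈ I, u n t := by rw [Finset.mul_sum]
      _ ≤ R * ∑ n ∈ Finset.range (N + 1), u n t := by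
          gcongr
          exact fun _ _ _ => hu0 _ _
      _ = R := by rw [husum, mul_one]
  refine ⟨fun i => ⟨_, hcont i⟩, ?_, ?_, ?_, ?_⟩
  · intro i j hij
    ext t
    simp only [ContinuousMap.mul_apply, ContinuousMap.coe_mk, ContinuousMap.zero_apply]
    rw [← Complex.ofReal_mul, huu i j hij t, Complex.ofReal_zero]
  · ext t
    simp only [ContinuousMap.sum_apply, ContinuousMap.coe_mk, ContinuousMap.one_apply]
    rw [← Complex.ofReal_sum, husum, Complex.ofReal_one]
  · intro a R I hR hI ha
    rw [ContinuousMap.norm_le _ hR]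
    intro t
    simp only [ContinuousMap.sum_apply, ContinuousMap.smul_apply, ContinuousMap.coe_mk, smul_eq_mul]
    exact hub a R I t hR hI fun n hn _ => ha n hn
  · intro a R v hR ha
    rw [ContinuousMap.norm_le _ hR]
    intro t
    have : (∑ n ∈ Finset.range (N + 1), a n • (⟨_, hcont n⟩ : C(K, ℂ)) - v) t =
        ∑ n ∈ Finset.range (N + 1), (a n - v t) * (u n t : ℂ) := by
      simp only [ContinuousMap.sub_apply, ContinuousMap.sum_apply, ContinuousMap.smul_apply,
        ContinuousMap.coe_mk, smul_eq_mul, sub_mul, Finset.sum_sub_distrib]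
      rw [← Finset.mul_sum, ← Complex.ofReal_sum, husum, Complex.ofReal_one, mul_one]
    rw [this]
    refine hub _ R _ t hR subset_rfl fun n hn0 hn => ha n t (by simp at hn0; omega) ?_
    by_contra h
    exact hn (hus n t (not_le.1 h))

/-- complexification of a real function -/
noncomputable def cx {K : Type*} [TopologicalSpace K] (x : C(K, ℝ)) : C(K, ℂ) :=
  ⟨fun t => (x t : ℂ), by fun_prop⟩

lemma real_case {K : Type*} [TopologicalSpace K] [CompactSpace K] {k : ℕ} (o : Fin k)
    (S : ContinuousMultilinearMap ℂ (fun _ : Fin k => C(K, ℂ)) ℂ)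
    (hS : ∀ (z : Fin k → C(K, ℂ)) (A : Set (Fin k)) (a b : Fin k), a ∈ A → b ∉ A →
      (∀ i ∈ A, ∀ j ∉ A, z i * z j = 0) → S z = 0)
    (x : C(K, ℝ)) (hx : ∀ t, |x t| ≤ 1) :
    S (fun _ => cx x) = S (Function.update (fun _ => 1) o (cx x ^ k)) := by
  have step : ∀ N : ℕ, ∃ p q : C(K, ℂ), ‖p - cx x‖ ≤ 2 / ((N : ℝ) + 1) ∧
      ‖q - cx x ^ k‖ ≤ k * (2 / ((N : ℝ) + 1)) ∧
      ‖S (fun _ => p) - S (Function.update (fun _ => 1) o q)‖ ≤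
        (4 * k) ^ k * (‖S‖ * (k * (2 * k * (2 / ((N : ℝ) + 1))))) := by
    intro N
    let y : C(K, ℝ) := ⟨fun t => ((N : ℝ) + 1) * (x t + 1) / 2, by fun_prop⟩
    have hN : (0 : ℝ) < (N : ℝ) + 1 := by positivity
    obtain ⟨U, hU, hU1, hb, hap⟩ := hats (N + 1) y
      (fun t => by
        have := (abs_le.1 (hx t)).1
        simp only [y, ContinuousMap.coe_mk]
        have : 0 ≤ x t + 1 := by linarith
        positivity)
      (fun t => by
        have := (abs_le.1 (hx t)).2
        simp only [y, ContinuousMap.coe_mk]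
        push_cast
        nlinarith)
    let cr : ℕ → ℝ := fun n => 2 * n / ((N : ℝ) + 1) - 1
    let c : ℕ → ℂ := fun n => (cr n : ℂ)
    have hc : ∀ n ≤ N + 1, ‖c n‖ ≤ 1 := by
      intro n hn
      have hn' : (n : ℝ) ≤ N + 1 := by exact_mod_cast hn
      simp only [c, Complex.norm_real, Real.norm_eq_abs, abs_le, cr]
      constructor
      · have : 0 ≤ 2 * (n : ℝ) / (N + 1) := by positivity
        linarith
      · have : 2 * (n : ℝ) / (N + 1) ≤ 2 := by rw [div_le_iff₀ hN]; linarith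
        linarith
    have hcx : ∀ (n : ℕ) t, |y t - n| ≤ 1 → ‖c n - cx x t‖ ≤ 2 / ((N : ℝ) + 1) := by
      intro n t h
      simp only [c, cx, ContinuousMap.coe_mk, ← Complex.ofReal_sub, Complex.norm_real,
        Real.norm_eq_abs]
      have e : cr n - x t = - ((2 / ((N : ℝ) + 1)) * (y t - n)) := by
        simp only [cr, y, ContinuousMap.coe_mk]; field_simp; ring
      rw [e, abs_neg, abs_mul, abs_of_nonneg (by positivity : 0 ≤ 2 / ((N : ℝ) + 1))]
      exact mul_le_of_le_one_right (by positivity) h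
    have hcxp : ∀ (n : ℕ) t, |y t - n| ≤ 1 → n ≤ N + 1 →
        ‖c n ^ k - (cx x ^ k) t‖ ≤ k * (2 / ((N : ℝ) + 1)) := by
      intro n t h hn
      have := prod_sub_pow (fun _ : Fin k => c n) (cx x t) _ (fun _ => hc n hn)
        (by simpa [cx] using hx t) (fun _ => hcx n t h)
      simpa using this
    refine ⟨∑ n ∈ Finset.range (N + 1 + 1), c n • U n,
      ∑ n ∈ Finset.range (N + 1 + 1), c n ^ k • U n, ?_, ?_, ?_⟩
    · exact hap c _ _ (by positivity) fun n t _ h => hcx n t h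
    · exact hap (fun n => c n ^ k) _ _ (by positivity) fun n t hn h => hcxp n t h hn
    · have := discr o S hS U hU (N + 1) hb c hc (2 * k * (2 / ((N : ℝ) + 1))) (by positivity) ?_
      · simpa [hU1] using this
      · intro n m h1 h2
        simp only [c, ← Complex.ofReal_sub, Complex.norm_real, Real.norm_eq_abs]
        have e : cr n - cr m = (n - m) * (2 / ((N : ℝ) + 1)) := by
          simp only [cr]; field_simp; ring
        rw [e, abs_mul, abs_of_nonneg (by positivity : 0 ≤ 2 / ((N : ℝ) + 1))]
        gcongr
        have h1' : (n : ℝ) < m + 2 * k := by exact_mod_cast h1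
        have h2' : (m : ℝ) < n + 2 * k := by exact_mod_cast h2
        rw [abs_le]; constructor <;> linarith
  choose p q hp hq hpq using step
  have lim0 : Tendsto (fun N : ℕ => 2 / ((N : ℝ) + 1)) atTop (𝓝 0) := by
    have := (tendsto_one_div_add_atTop_nhds_zero_nat (𝕜 := ℝ)).const_mul 2
    simpa [div_eq_mul_inv] using this
  have hp' : Tendsto p atTop (𝓝 (cx x)) := by
    rw [tendsto_iff_norm_sub_tendsto_zero]
    exact squeeze_zero (fun _ => norm_nonneg _) hp lim0
  have hq' : Tendsto q atTop (𝓝 (cx x ^ k)) := by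
    rw [tendsto_iff_norm_sub_tendsto_zero]
    exact squeeze_zero (fun _ => norm_nonneg _) hq (by simpa using lim0.const_mul (k : ℝ))
  have h1 : Tendsto (fun N => S (fun _ => p N)) atTop (𝓝 (S (fun _ => cx x))) :=
    (S.cont.tendsto _).comp (tendsto_pi_nhds.2 fun _ => hp')
  have h2 : Tendsto (fun N => S (Function.update (fun _ => 1) o (q N))) atTop
      (𝓝 (S (Function.update (fun _ => 1) o (cx x ^ k)))) :=
    (S.cont.tendsto _).comp (tendsto_const_nhds.update o hq')
  have h3 := h1.sub h2
  have h4 : Tendsto (fun N => S (fun _ => p N) - S (Function.update (fun _ => 1) o (q N)))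
      atTop (𝓝 0) := by
    rw [tendsto_zero_iff_norm_tendsto_zero]
    refine squeeze_zero (fun _ => norm_nonneg _) hpq ?_
    simpa using ((((lim0.const_mul (2 * k : ℝ)).const_mul (k : ℝ)).const_mul ‖S‖).const_mul
      ((4 * k : ℝ) ^ k))
  exact sub_eq_zero.1 (tendsto_nhds_unique h3 h4)

lemma rep {K : Type*} [TopologicalSpace K] [CompactSpace K] {k : ℕ} (hk : 1 ≤ k)
    (M : ContinuousMultilinearMap ℂ (fun _ : Fin k => C(K, ℂ)) ℂ)
    (hM : IsOrthAdd fun x => M (fun _ => x)) (C : ℝ) (hC0 : 0 ≤ C)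
    (hC : ∀ x, ‖M (fun _ => x)‖ ≤ C * ‖x‖ ^ k) :
    ∃ φ : C(K, ℂ) →L[ℂ] ℂ, (∀ x, M (fun _ => x) = φ (x ^ k)) ∧
      ‖φ‖ ≤ C * (2 * Real.exp 1) ^ k := by
  let o : Fin k := ⟨0, hk⟩
  let S := sym M
  have hS : ∀ (z : Fin k → C(K, ℂ)) (A : Set (Fin k)) (a b : Fin k), a ∈ A → b ∉ A →
      (∀ i ∈ A, ∀ j ∉ A, z i * z j = 0) → S z = 0 :=
    fun z A a b ha hb hz => sym_vanish M hM z A a b ha hb hz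
  let φ : C(K, ℂ) →L[ℂ] ℂ :=
    ((k.factorial : ℂ)⁻¹) • S.toContinuousLinearMap (fun _ => 1) o
  have hφ : ∀ z, φ z = (k.factorial : ℂ)⁻¹ * S (Function.update (fun _ => 1) o z) := fun z => rfl
  have hfac : (k.factorial : ℂ) ≠ 0 := by exact_mod_cast k.factorial_ne_zero
  have hsmall : ∀ x : C(K, ℝ), (∀ t, |x t| ≤ 1) → M (fun _ => cx x) = φ (cx x ^ k) := by
    intro x hx
    rw [hφ, ← real_case o S hS x hx, sym_diag, inv_mul_cancel_left₀ hfac]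
  have hMs : ∀ (c : ℂ) (x : C(K, ℂ)), M (fun _ => c • x) = c ^ k * M (fun _ => x) := by
    intro c x
    have := M.map_smul_univ (fun _ => c) (fun _ => x)
    simpa using this
  have hreal : ∀ x : C(K, ℝ), M (fun _ => cx x) = φ (cx x ^ k) := by
    intro x
    have hpos : 0 < ‖x‖ + 1 := by positivity
    have h1 := hsmall ((‖x‖ + 1)⁻¹ • x) (fun t => by
      have : |x t| ≤ ‖x‖ := x.norm_coe_le_norm t
      rw [ContinuousMap.smul_apply, smul_eq_mul, abs_mul, abs_of_pos (inv_pos.2 hpos),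
        inv_mul_le_iff₀ hpos]
      linarith)
    have h2 : cx ((‖x‖ + 1)⁻¹ • x) = (((‖x‖ + 1)⁻¹ : ℝ) : ℂ) • cx x := by
      ext t; simp [cx]
    rw [h2, hMs, smul_pow, map_smul, smul_eq_mul] at h1
    refine mul_left_cancel₀ (pow_ne_zero k ?_) h1
    exact_mod_cast (inv_pos.2 hpos).ne'
  refine ⟨φ, ?_, ?_⟩
  · intro x
    let u : C(K, ℝ) := ⟨fun t => (x t).re, by fun_prop⟩
    let v : C(K, ℝ) := ⟨fun t => (x t).im, by fun_prop⟩
    let F : ℂ → ℂ := fun ζ => M (fun _ => cx u + ζ • cx v)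
    let G : ℂ → ℂ := fun ζ => φ ((cx u + ζ • cx v) ^ k)
    have hF : Differentiable ℂ F := by
      have h1 : Differentiable ℂ (fun ζ : ℂ => (fun _ : Fin k => cx u + ζ • cx v)) := by
        fun_prop
      exact fun ζ => (M.hasFDerivAt _).differentiableAt.comp ζ (h1 ζ)
    have hG : Differentiable ℂ G := by
      have h1 : Differentiable ℂ (fun ζ : ℂ => (cx u + ζ • cx v) ^ k) := by fun_prop
      exact φ.differentiable.comp h1
    have hFG : F = G := by
      refine AnalyticOnNhd.eq_of_frequently_eq (z₀ := 0)
        (hF.differentiableOn.analyticOnNhd isOpen_univ)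
        (hG.differentiableOn.analyticOnNhd isOpen_univ) ?_
      have hfr : ∃ᶠ s : ℝ in 𝓝[≠] 0, F (s : ℂ) = G (s : ℂ) := by
        refine Eventually.frequently (Eventually.of_forall fun s => ?_)
        have : cx u + (s : ℂ) • cx v = cx (u + s • v) := by ext t; simp [cx]
        simp only [F, G, this]
        exact hreal _
      have ht : Tendsto (fun s : ℝ => (s : ℂ)) (𝓝[≠] 0) (𝓝[≠] 0) := by
        refine tendsto_nhdsWithin_iff.2 ⟨?_, ?_⟩
        · have : Tendsto (fun s : ℝ => (s : ℂ)) (𝓝 0) (𝓝 ((0 : ℝ) : ℂ)) :=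
            Complex.continuous_ofReal.tendsto 0
          rw [Complex.ofReal_zero] at this
          exact this.mono_left nhdsWithin_le_nhds
        · filter_upwards [self_mem_nhdsWithin] with s hs
          simpa using hs
      exact ht.frequently hfr
    have hx : x = cx u + Complex.I • cx v := by
      ext t
      simp only [cx, u, v, ContinuousMap.add_apply, ContinuousMap.smul_apply, ContinuousMap.coe_mk,
        smul_eq_mul]
      rw [mul_comm, Complex.re_add_im]
    have := congrFun hFG Complex.I
    simp only [F, G, ← hx] at this
    exact this
  · refine ContinuousLinearMap.opNorm_le_of_unit_norm (𝕜 := ℂ) (by positivity) ?_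
    intro z hz
    have h1 : ‖S (Function.update (fun _ => 1) o z)‖ ≤ 2 ^ k * (C * k ^ k) := by
      refine sym_bound M C hC hC0 _ ?_
      intro i
      by_cases h : i = o
      · subst h; simp [hz]
      · rw [Function.update_of_ne h, ContinuousMap.norm_le _ zero_le_one]; simp
    rw [hφ, norm_mul, norm_inv, Complex.norm_natCast]
    have h2 : (k : ℝ) ^ k / k.factorial ≤ Real.exp k := Real.pow_div_factorial_le_exp _ (by positivity) k
    calc (k.factorial : ℝ)⁻¹ * ‖S (Function.update (fun _ => 1) o z)‖
        ≤ (k.factorial : ℝ)⁻¹ * (2 ^ k * (C * k ^ k)) := by gcongr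
      _ = C * 2 ^ k * ((k : ℝ) ^ k / k.factorial) := by ring
      _ ≤ C * 2 ^ k * Real.exp k := by gcongr
      _ = C * (2 * Real.exp 1) ^ k := by
          rw [mul_pow, ← Real.exp_nat_mul, mul_one]; ring

lemma rmk {X : Type*} [TopologicalSpace X] [CompactSpace X] [T2Space X] [MeasurableSpace X]
    [BorelSpace X] {E : Type*} [AddCommGroup E] [Module ℝ E] (A : E →ₗ[ℝ] C(X, ℝ))
    (ψ : E →ₗ[ℝ] ℝ) (C : ℝ) (hC : 0 ≤ C) (h : ∀ y, ψ y ≤ C * ‖A y ⊔ 0‖) :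
    ∃ μ : Measure X, IsFiniteMeasure μ ∧ (μ Set.univ).toReal ≤ C ∧
      ∀ y, ψ y = ∫ s, A y s ∂μ := by
  let N : C(X, ℝ) → ℝ := fun g => C * ‖g ⊔ 0‖
  have hle : ∀ g g' : C(X, ℝ), (∀ s, max (g s) 0 ≤ ‖g'‖) → ‖g ⊔ 0‖ ≤ ‖g'‖ := by
    intro g g' hg
    rw [ContinuousMap.norm_le _ (norm_nonneg _)]
    intro s
    rw [ContinuousMap.sup_apply, ContinuousMap.zero_apply, Real.norm_of_nonneg (le_max_right _ _)]
    exact hg s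
  have hpt : ∀ (g : C(X, ℝ)) (s : X), max (g s) 0 ≤ ‖g ⊔ 0‖ := by
    intro g s
    have := (g ⊔ 0).norm_coe_le_norm s
    rw [ContinuousMap.sup_apply, ContinuousMap.zero_apply] at this
    exact (le_abs_self _).trans this
  have hker : ∀ y, A y = 0 → ψ y = 0 := by
    intro y hy
    have h1 := h y
    have h2 := h (-y)
    simp [hy] at h1 h2
    linarith
  -- functional on the range
  obtain ⟨f, hf⟩ : ∃ f : LinearMap.range A →ₗ[ℝ] ℝ, ∀ y, f ⟨A y, ⟨y, rfl⟩⟩ = ψ y := by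
    have hk : LinearMap.ker A.rangeRestrict ≤ LinearMap.ker ψ := by
      intro y hy
      rw [LinearMap.ker_rangeRestrict] at hy
      exact hker y hy
    obtain ⟨g, hg⟩ := A.rangeRestrict.exists_rightInverse_of_surjective A.range_rangeRestrict
    refine ⟨ψ ∘ₗ g, fun y => ?_⟩
    have h1 : A.rangeRestrict (g ⟨A y, ⟨y, rfl⟩⟩) = ⟨A y, ⟨y, rfl⟩⟩ := LinearMap.congr_fun hg _
    have h2 : g ⟨A y, ⟨y, rfl⟩⟩ - y ∈ LinearMap.ker A.rangeRestrict := by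
      rw [LinearMap.mem_ker, map_sub, h1]
      simp [Subtype.ext_iff]
    have h3 := hk h2
    rw [LinearMap.mem_ker, map_sub, sub_eq_zero] at h3
    exact h3
  obtain ⟨g, hg1, hg2⟩ := exists_extension_of_le_sublinear ⟨LinearMap.range A, f⟩ N
    (by
      intro c hc x
      have : (c • x) ⊔ 0 = c • (x ⊔ 0) := by
        ext s
        simp only [ContinuousMap.sup_apply, ContinuousMap.smul_apply, ContinuousMap.zero_apply,
          smul_eq_mul]
        rw [mul_max_of_nonneg _ _ hc.le, mul_zero]
      simp only [N, this, norm_smul, Real.norm_of_nonneg hc.le]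
      ring)
    (by
      intro x y
      simp only [N, ← mul_add]
      gcongr
      rw [ContinuousMap.norm_le _ (by positivity)]
      intro s
      rw [ContinuousMap.sup_apply, ContinuousMap.zero_apply, Real.norm_of_nonneg (le_max_right _ _)]
      have h1 := hpt x s
      have h2 := hpt y s
      rw [max_le_iff] at h1 h2
      apply max_le
      · rw [ContinuousMap.add_apply]; linarith
      · positivity)
    (by
      rintro ⟨_, y, rfl⟩
      have : f ⟨A y, ⟨y, rfl⟩⟩ = ψ y := hf y
      simp only [LinearPMap.mk_apply, this]
      exact h y)
  have hpos : ∀ x : C(X, ℝ), 0 ≤ x → 0 ≤ g x := by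
    intro x hx
    have h1 := hg2 (-x)
    have : (-x) ⊔ 0 = 0 := sup_eq_right.2 (by simpa using hx)
    simp only [N, this, norm_zero, mul_zero, map_neg] at h1
    linarith
  let e : CompactlySupportedContinuousMap X ℝ →ₗ[ℝ] C(X, ℝ) :=
    { toFun := fun x => x.toContinuousMap
      map_add' := fun _ _ => rfl
      map_smul' := fun _ _ => rfl }
  let Λ : CompactlySupportedContinuousMap X ℝ →ₚ[ℝ] ℝ := PositiveLinearMap.mk₀ (g ∘ₗ e)
    (fun x hx => hpos _ hx)
  have hint : ∀ x : C(X, ℝ), ∫ s, x s ∂(RealRMK.rieszMeasure Λ) = g x := fun x =>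
    RealRMK.integral_rieszMeasure Λ ⟨x, HasCompactSupport.of_compactSpace _⟩
  have hfin : IsFiniteMeasure (RealRMK.rieszMeasure Λ) := by
    infer_instance
  refine ⟨RealRMK.rieszMeasure Λ, hfin, ?_, ?_⟩
  · have h1 := hint 1
    simp only [ContinuousMap.one_apply, integral_const, smul_eq_mul, mul_one] at h1
    change (RealRMK.rieszMeasure Λ).real Set.univ ≤ C
    rw [h1]
    refine (hg2 1).trans ?_
    have : ‖(1 : C(X, ℝ)) ⊔ 0‖ ≤ 1 := by
      rw [ContinuousMap.norm_le _ zero_le_one]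
      intro s
      simp
    exact mul_le_of_le_one_right hC this
  · intro y
    rw [hint, ← hf y]
    exact (hg1 ⟨A y, ⟨y, rfl⟩⟩).symm

lemma meas {K : Type*} [TopologicalSpace K] [CompactSpace K] [T2Space K] {k : ℕ} (hk : 1 ≤ k)
    (φ : C(K, ℂ) →L[ℂ] ℂ) (C : ℝ) (hC : 0 ≤ C) (hφ : ‖φ‖ ≤ C) :
    ∃ ν : Measure (DualBall K), IsFiniteMeasure ν ∧ (ν Set.univ).toReal ≤ C ∧
      ∀ x : C(K, ℂ), φ (x ^ k) = ∫ γ, (γ.1 x) ^ k * (1 : ℂ) ∂ν := by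
  letI : MeasurableSpace (Circle × K) := borel _
  haveI : BorelSpace (Circle × K) := ⟨rfl⟩
  haveI : BorelSpace (DualBall K) := ⟨rfl⟩
  let A : C(K, ℂ) →ₗ[ℝ] C(Circle × K, ℝ) :=
    { toFun := fun y => ⟨fun s => ((s.1 : ℂ) ^ k * y s.2).re, by fun_prop⟩
      map_add' := fun x y => by ext s; simp [mul_add]
      map_smul' := fun c y => by ext s; simp; ring }
  have hA : ∀ y s, A y s = ((s.1 : ℂ) ^ k * y s.2).re := fun _ _ => rfl
  let ψ : C(K, ℂ) →ₗ[ℝ] ℝ :=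
    { toFun := fun y => (φ y).re
      map_add' := fun x y => by simp
      map_smul' := fun c y => by simp }
  have hψ : ∀ y, ψ y = (φ y).re := fun _ => rfl
  obtain ⟨μ, hμ, hμC, hint⟩ := rmk A ψ C hC (by
    intro y
    rw [hψ]
    refine (Complex.re_le_norm _).trans ((φ.le_of_opNorm_le hφ y).trans ?_)
    gcongr
    rw [ContinuousMap.norm_le _ (norm_nonneg _)]
    intro t
    let ζ : Circle := Circle.exp (-(Complex.arg (y t)) / k)
    have h1 : (A y ⊔ 0) (ζ, t) ≤ ‖A y ⊔ 0‖ := (le_abs_self _).trans ((A y ⊔ 0).norm_coe_le_norm _)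
    refine le_trans ?_ h1
    rw [ContinuousMap.sup_apply]
    refine le_trans (le_of_eq ?_) (le_max_left _ _)
    rw [hA]
    have h2 : (ζ : ℂ) ^ k * y t = (‖y t‖ : ℂ) := by
      have hk' : (k : ℂ) ≠ 0 := by exact_mod_cast (by omega : k ≠ 0)
      conv_lhs => rw [← Complex.norm_mul_exp_arg_mul_I (y t)]
      rw [Circle.coe_exp, ← Complex.exp_nat_mul, mul_left_comm, ← Complex.exp_add]
      have : (k : ℂ) * (((-(Complex.arg (y t)) / k : ℝ) : ℂ) * Complex.I) +
          (Complex.arg (y t) : ℂ) * Complex.I = 0 := by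
        push_cast; field_simp; ring
      rw [this]; simp
    simp only [h2, Complex.ofReal_re])
  have hcI : ∀ y : C(K, ℂ), Integrable (fun s : Circle × K => (s.1 : ℂ) ^ k * y s.2) μ := by
    intro y
    exact Continuous.integrable_of_hasCompactSupport (by fun_prop)
      (HasCompactSupport.of_compactSpace _)
  have hrep : ∀ y : C(K, ℂ), φ y = ∫ s, (s.1 : ℂ) ^ k * y s.2 ∂μ := by
    intro y
    have hre : ∀ z : C(K, ℂ), (φ z).re = (∫ s, (s.1 : ℂ) ^ k * z s.2 ∂μ).re := by
      intro z
      rw [← hψ, hint z]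
      exact Complex.reCLM.integral_comp_comm (hcI z)
    have h2 := hre (Complex.I • y)
    have e : (fun s : Circle × K => (s.1 : ℂ) ^ k * (Complex.I • y) s.2) =
        fun s => Complex.I * ((s.1 : ℂ) ^ k * y s.2) := by
      ext s; simp; ring
    rw [map_smul, e, integral_const_mul] at h2
    refine Complex.ext (hre y) ?_
    simpa using h2
  let Ψ : Circle × K → DualBall K := fun s =>
    ⟨StrongDual.toWeakDual ((s.1 : ℂ) • ContinuousMap.evalCLM ℂ s.2), fun x => by
      have : (StrongDual.toWeakDual ((s.1 : ℂ) • ContinuousMap.evalCLM ℂ s.2)) x =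
        (s.1 : ℂ) * x s.2 := rfl
      rw [this, norm_mul, Circle.norm_coe, one_mul]
      exact x.norm_coe_le_norm _⟩
  have hΨ : ∀ s x, (Ψ s).1 x = (s.1 : ℂ) * x s.2 := fun _ _ => rfl
  have hΨc : Continuous Ψ := by
    refine Continuous.subtype_mk ?_ _
    refine WeakDual.continuous_of_continuous_eval fun x => ?_
    change Continuous fun s : Circle × K => (s.1 : ℂ) * x s.2
    fun_prop
  refine ⟨μ.map Ψ, inferInstance, ?_, ?_⟩
  · rw [Measure.map_apply hΨc.measurable MeasurableSet.univ]
    simpa using hμC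
  · intro x
    have hc : Continuous fun γ : DualBall K => (γ.1 x) ^ k * (1 : ℂ) :=
      (((WeakDual.eval_continuous x).comp continuous_subtype_val).pow k).mul continuous_const
    rw [integral_map hΨc.measurable.aemeasurable hc.measurable.aestronglyMeasurable, hrep]
    refine integral_congr_ae (Eventually.of_forall fun s => ?_)
    simp [hΨ, mul_pow]

lemma coeff_zero (a : ℕ → ℂ) (h : ∀ t : ℂ, HasSum (fun k => t ^ (k + 1) * a k) 0) (k : ℕ) :
    a k = 0 := by
  let b : ℕ → ℂ := fun n => if n = 0 then 0 else a (n - 1)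
  have hp : HasFPowerSeriesAt (fun _ : ℂ => (0 : ℂ)) (FormalMultilinearSeries.ofScalars ℂ b) 0 := by
    rw [hasFPowerSeriesAt_iff]
    refine Eventually.of_forall fun z => ?_
    have : HasSum (fun n => z ^ n * b n) 0 := by
      rw [← hasSum_nat_add_iff' 1]
      simpa [b] using h z
    simpa [FormalMultilinearSeries.coeff_ofScalars] using this
  have h0 := hp.eq_zero
  have := FormalMultilinearSeries.coeff_ofScalars (𝕜 := ℂ) (p := b) (n := k + 1)
  rw [h0] at this
  simpa [b, FormalMultilinearSeries.coeff] using this.symm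

lemma norm_le_polyNorm {K : Type*} [TopologicalSpace K] [CompactSpace K] {k : ℕ}
    (P : C(K, ℂ) → ℂ) (M : ContinuousMultilinearMap ℂ (fun _ : Fin k => C(K, ℂ)) ℂ)
    (hPM : ∀ x, P x = M (fun _ => x)) (x : C(K, ℂ)) :
    ‖M (fun _ => x)‖ ≤ polyNorm P * ‖x‖ ^ k := by
  have hbdd : BddAbove ((fun x => ‖P x‖) '' Metric.closedBall (0 : C(K, ℂ)) 1) := by
    refine ⟨‖M‖, ?_⟩
    rintro _ ⟨y, hy, rfl⟩
    simp only [hPM]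
    refine (M.le_opNorm _).trans ?_
    have hy' : ‖y‖ ≤ 1 := by simpa using hy
    simp only [Finset.prod_const, Finset.card_univ, Fintype.card_fin]
    exact mul_le_of_le_one_right (norm_nonneg _) (pow_le_one₀ (norm_nonneg _) hy')
  have hMs : ∀ (c : ℂ) (x : C(K, ℂ)), M (fun _ => c • x) = c ^ k * M (fun _ => x) := by
    intro c x
    have := M.map_smul_univ (fun _ => c) (fun _ => x)
    simpa using this
  have h1 : ∀ y : C(K, ℂ), ‖y‖ ≤ 1 → ‖M (fun _ => y)‖ ≤ polyNorm P := by
    intro y hy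
    exact le_csSup hbdd ⟨y, by simpa using hy, by simp only [hPM]⟩
  by_cases hx : x = 0
  · subst hx
    rcases Nat.eq_zero_or_pos k with rfl | hk
    · simpa using h1 0 (by simp)
    · have : M (fun _ => (0 : C(K, ℂ))) = 0 := M.map_coord_zero (⟨0, hk⟩ : Fin k) rfl
      rw [this]; simp [hk.ne']
  · have hn : ‖x‖ ≠ 0 := norm_ne_zero_iff.2 hx
    have h2 := h1 (((‖x‖⁻¹ : ℝ) : ℂ) • x) (by
      rw [norm_smul, Complex.norm_real, norm_inv, norm_norm, inv_mul_cancel₀ hn])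
    rw [hMs, norm_mul, norm_pow, Complex.norm_real, norm_inv, norm_norm, inv_pow,
      inv_mul_le_iff₀ (by positivity)] at h2
    linarith

end OA

/-- If `f` is an orthogonally additive holomorphic function of bounded type on
`C(K)` with Taylor expansion `f = ∑_{k ≥ 1} Pₖ` at zero, then each Taylor
polynomial `Pₖ` is represented by a complex Borel measure `νₖ` (in polar form
`wₖ · νₖ`) on the weak-* dual unit ball, and the total variations are summable:
`∑_{k ≥ 1} |νₖ|(B') < ∞`, i.e. the sum of the integral norms is finite. -/
theorem orthAdd_boundedType_taylor_integral_summable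
    {K : Type*} [TopologicalSpace K] [CompactSpace K] [T2Space K]
    (f : C(K, ℂ) → ℂ) (P : ℕ → C(K, ℂ) → ℂ)
    (hP : ∀ k, 1 ≤ k → IsHomogPoly k (P k))
    (hf : ∀ x : C(K, ℂ), HasSum (fun k : ℕ => P (k + 1) x) (f x))
    (hb : ∀ r : ℝ, 0 < r → Summable (fun k : ℕ => polyNorm (P (k + 1)) * r ^ (k + 1)))
    (hOA : IsOrthAdd f) :
    ∃ (ν : ℕ → Measure (DualBall K)) (w : ℕ → DualBall K → ℂ),
      (∀ k, 1 ≤ k → IsFiniteMeasure (ν k)) ∧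
      (∀ k, 1 ≤ k → Measurable (w k)) ∧
      (∀ k, 1 ≤ k → ∀ γ, ‖w k γ‖ = 1) ∧
      (∀ k, 1 ≤ k → ∀ x : C(K, ℂ), P k x = ∫ γ, (γ.1 x) ^ k * w k γ ∂(ν k)) ∧
      Summable (fun k : ℕ => (ν (k + 1) Set.univ).toReal) := by
  have hM : ∀ k, ∃ M : ContinuousMultilinearMap ℂ (fun _ : Fin (k + 1) => C(K, ℂ)) ℂ,
      ∀ x, P (k + 1) x = M (fun _ => x) := fun k => hP (k + 1) (by omega)
  choose M hM using hM
  have hhom : ∀ k (t : ℂ) x, P (k + 1) (t • x) = t ^ (k + 1) * P (k + 1) x := by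
    intro k t x
    have := (M k).map_smul_univ (fun _ => t) (fun _ => x)
    rw [hM, hM]
    simpa using this
  have hPOA : ∀ k, IsOrthAdd (P (k + 1)) := by
    intro k x y hxy
    have := OA.coeff_zero (fun k => P (k + 1) (x + y) - (P (k + 1) x + P (k + 1) y)) (by
      intro t
      have h1 := (hf (t • (x + y))).sub ((hf (t • x)).add (hf (t • y)))
      have h2 : f (t • (x + y)) = f (t • x) + f (t • y) := by
        rw [smul_add]
        refine hOA _ _ ?_
        rw [smul_mul_smul_comm, hxy, smul_zero]
      rw [h2, sub_self] at h1
      refine h1.congr_fun ?_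
      intro k
      simp only [hhom]
      ring) k
    exact sub_eq_zero.1 this
  have hpn : ∀ k, 0 ≤ polyNorm (P (k + 1)) := by
    intro k
    refine Real.sSup_nonneg ?_
    rintro _ ⟨x, _, rfl⟩
    exact norm_nonneg _
  have hmain : ∀ k, ∃ ν : Measure (DualBall K), IsFiniteMeasure ν ∧
      (ν Set.univ).toReal ≤ polyNorm (P (k + 1)) * (2 * Real.exp 1) ^ (k + 1) ∧
      ∀ x : C(K, ℂ), P (k + 1) x = ∫ γ, (γ.1 x) ^ (k + 1) * (1 : ℂ) ∂ν := by
    intro k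
    have hOA' : IsOrthAdd fun x => M k (fun _ => x) := by
      intro x y hxy
      simp only [← hM]
      exact hPOA k x y hxy
    obtain ⟨φ, h1, h2⟩ := OA.rep (by omega) (M k) hOA' _ (hpn k)
      (OA.norm_le_polyNorm (P (k + 1)) (M k) (hM k))
    have hpn' := hpn k
    obtain ⟨ν, h3, h4, h5⟩ := OA.meas (k := k + 1) (by omega) φ _ (by positivity) h2
    exact ⟨ν, h3, h4, fun x => by rw [hM, h1, h5]⟩
  choose ν h1 h2 h3 using hmain
  refine ⟨fun k => ν (k - 1), fun _ _ => 1, ?_, ?_, ?_, ?_, ?_⟩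
  · intro k _; exact h1 _
  · intro k _; exact measurable_const
  · intro k _ γ; simp
  · intro k hk x
    obtain ⟨j, rfl⟩ : ∃ j, k = j + 1 := ⟨k - 1, by omega⟩
    exact h3 j x
  · refine Summable.of_nonneg_of_le (fun _ => ENNReal.toReal_nonneg) (fun k => ?_)
      (hb (2 * Real.exp 1) (by positivity))
    exact h2 k
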